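/- Let p, q ≥ 1 and let Q₁, …, Q_q be homogeneous quadratic polynomials on ℝᵖ satisfying ⟨∇Q_i(ξ), ∇Q_j(ξ)⟩ = 3δ_{ij}|ξ|² for all ξ ∈ ℝᵖ and all i, j. Let M_i be the symmetric p×p matrix with Q_i(ξ) = ⟨M_iξ, ξ⟩, and set A_i = (2/√3)·M_i. Then each A_i is symmetric, A_i² = 1ₚ, and A_iA_j + A_jA_i = 0 for all i ≠ j. In particular the A_i form a symmetric solution of the Hurwitz matrix equations of size [q, p, p]. -/

import Mathlib

open Matrix MvPolynomial

/-- A symmetric real matrix whose quadratic form vanishes is zero. -/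
theorem Matrix.IsSymm.eq_zero_of_dotProduct_mulVec_self {n : Type*} [Fintype n]
    {B : Matrix n n ℝ} (hB : B.IsSymm) (h : ∀ x : n → ℝ, x ⬝ᵥ B *ᵥ x = 0) : B = 0 := by
  classical
  ext a b
  have hab := h (Pi.single a 1 + Pi.single b 1)
  have ha := h (Pi.single a 1)
  have hb := h (Pi.single b 1)
  simp only [mulVec_add, add_dotProduct, dotProduct_add, single_one_dotProduct,
    mulVec_single_one, col_apply] at hab ha hb
  have := hB.apply a b
  rw [zero_apply]
  linarith

/-- The gradient of the quadratic form of a symmetric matrix `A` at `x` is `2 A x`. -/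
theorem MvPolynomial.eval_pderiv_of_eval_eq_mulVec_dotProduct {n : Type*} [Fintype n]
    {P : MvPolynomial n ℝ} {A : Matrix n n ℝ} (hA : A.IsSymm)
    (hP : ∀ x : n → ℝ, eval x P = A *ᵥ x ⬝ᵥ x) (x : n → ℝ) (k : n) :
    eval x (pderiv k P) = 2 * (A *ᵥ x) k := by
  classical
  have hPA : P = ∑ a, ∑ b, C (A a b) * X b * X a := by
    refine MvPolynomial.funext fun y => ?_
    simp [hP, mulVec, dotProduct, Finset.sum_mul]
  rw [hPA]
  simp only [map_sum, Derivation.leibniz, pderiv_X, pderiv_C, smul_eq_mul, map_add, map_mul,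
    eval_C, eval_X, mul_zero, add_zero, Finset.sum_add_distrib, Pi.single_apply, mul_ite,
    mul_one, apply_ite (eval x), map_zero]
  simp [mulVec, dotProduct, two_mul]
  simp only [mul_comm, hA.apply]

/-- If the quadratic forms `Q₁, …, Q_q` on `ℝᵖ` satisfy `⟨∇Qᵢ, ∇Qⱼ⟩ = 3δᵢⱼ|ξ|²`, and
`Mᵢ` is the symmetric matrix with `Qᵢ(ξ) = ⟨Mᵢξ, ξ⟩`, then the matrices
`Aᵢ = (2/√3)Mᵢ` are symmetric, satisfy `Aᵢ² = 1ₚ`, and pairwise anticommute; i.e.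
they form a symmetric solution of the Hurwitz matrix equations of size `[q, p, p]`. -/
theorem quadratic_system_gives_hurwitz_matrices (p q : ℕ) (hp : 1 ≤ p) (hq : 1 ≤ q)
    (Q : Fin q → MvPolynomial (Fin p) ℝ) (hQ : ∀ i, (Q i).IsHomogeneous 2)
    (hgrad : ∀ (ξ : Fin p → ℝ) (i j : Fin q),
      ∑ k, eval ξ (pderiv k (Q i)) * eval ξ (pderiv k (Q j)) =
        (if i = j then 3 else 0) * ∑ k, ξ k ^ 2)
    (M : Fin q → Matrix (Fin p) (Fin p) ℝ)
    (hMsymm : ∀ i, (M i).IsSymm)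
    (hMQ : ∀ (i : Fin q) (ξ : Fin p → ℝ), eval ξ (Q i) = (M i).mulVec ξ ⬝ᵥ ξ) :
    (∀ i, ((2 / Real.sqrt 3) • M i).IsSymm) ∧
    (∀ i, ((2 / Real.sqrt 3) • M i) * ((2 / Real.sqrt 3) • M i) = 1) ∧
    (∀ i j, i ≠ j →
      ((2 / Real.sqrt 3) • M i) * ((2 / Real.sqrt 3) • M j) +
        ((2 / Real.sqrt 3) • M j) * ((2 / Real.sqrt 3) • M i) = 0) := by
  have hanti : ∀ i j, (2 : ℝ) • (M i * M j + M j * M i) =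
      (if i = j then (3 : ℝ) else 0) • (1 : Matrix (Fin p) (Fin p) ℝ) := by
    intro i j
    rw [← sub_eq_zero]
    refine IsSymm.eq_zero_of_dotProduct_mulVec_self ?_ fun ξ => ?_
    · simp only [IsSymm, transpose_sub, transpose_smul, transpose_add, transpose_mul,
        transpose_one, (hMsymm i).eq, (hMsymm j).eq]
      rw [add_comm]
    · have hform : ∀ i j, ξ ⬝ᵥ (M i * M j) *ᵥ ξ = (M i *ᵥ ξ) ⬝ᵥ (M j *ᵥ ξ) := fun i j => by
        rw [← mulVec_mulVec, dotProduct_mulVec, ← mulVec_transpose, (hMsymm i).eq]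
      have h := hgrad ξ i j
      simp only [eval_pderiv_of_eval_eq_mulVec_dotProduct (hMsymm _) (hMQ _)] at h
      have h4 : 4 * (M i *ᵥ ξ ⬝ᵥ M j *ᵥ ξ) = (if i = j then 3 else 0) * (ξ ⬝ᵥ ξ) := by
        simp only [dotProduct, ← pow_two, ← h, Finset.mul_sum]
        exact Finset.sum_congr rfl fun k _ => by ring
      simp only [sub_mulVec, smul_mulVec, add_mulVec, one_mulVec, dotProduct_sub, dotProduct_smul,
        dotProduct_add, hform, smul_eq_mul, dotProduct_comm (M j *ᵥ ξ)]
      linarith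
  have hscal : (2 / Real.sqrt 3) * (2 / Real.sqrt 3) = 4 / 3 := by
    rw [div_mul_div_comm, Real.mul_self_sqrt (by norm_num)]
    norm_num
  refine ⟨fun i => (hMsymm i).smul _, fun i => ?_, fun i j hij => ?_⟩
  · have h := hanti i i
    rw [if_pos rfl, ← two_smul ℝ, smul_smul] at h
    rw [smul_mul_smul_comm, hscal, show (4 / 3 : ℝ) = 3⁻¹ * (2 * 2) by norm_num, mul_smul, h,
      smul_smul]
    norm_num
  · have h := hanti i j
    rw [if_neg hij, zero_smul] at h
    rw [smul_mul_smul_comm, smul_mul_smul_comm, ← smul_add,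
      (smul_eq_zero.mp h).resolve_left two_ne_zero, smul_zero]
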